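/- arXiv:0901.0353 — 12 statements merged into one kernel-verified Lean document; each statement's English description precedes it below -/
import Mathlib

section
/- Let r ≥ 1 and n ≥ 0 be integers and let q, w ∈ ℂ with 0 < |q| < 1 and |w| < 1. Then the series (1+q)^r · ∑_{m=0}^∞ C(m+r-1, m) (-1)^m w^m [m]_q^n converges, and its sum equals the finite sum (1/(1-q)^n) · ∑_{l=0}^n C(n,l) (-1)^l ((1+q)/(1+w q^l))^r. (This expresses the w-q-Euler number of order r, E_{n,w,q}^{(r)}, as a convergent infinite series.) -/
theorem one_sub_pow_eq_sum_choose {R : Type*} [CommRing R] (x : R) (n : ℕ) :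
    (1 - x) ^ n = ∑ l ∈ Finset.range (n + 1), (n.choose l : R) * (-1) ^ l * x ^ l := by
  rw [sub_eq_neg_add, add_pow]
  refine Finset.sum_congr rfl fun l _ => ?_
  rw [neg_pow x]
  ring

/-- For integers `r ≥ 1`, `n ≥ 0` and complex `q, w` with `0 < |q| < 1`,
`|w| < 1`, the series `(1+q)^r ∑_{m=0}^∞ C(m+r-1,m) (-1)^m w^m [m]_q^n` converges to
`(1/(1-q)^n) ∑_{l=0}^n C(n,l) (-1)^l ((1+q)/(1+w q^l))^r`, where `[m]_q = (1-q^m)/(1-q)`. -/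
theorem stmt_0 (r n : ℕ) (hr : 1 ≤ r) (q w : ℂ)
    (hq0 : 0 < ‖q‖) (hq1 : ‖q‖ < 1) (hw : ‖w‖ < 1) :
    HasSum
      (fun m : ℕ => (1 + q) ^ r * ((m + r - 1).choose m : ℂ) * (-1) ^ m * w ^ m *
        ((1 - q ^ m) / (1 - q)) ^ n)
      ((1 / (1 - q) ^ n) * ∑ l ∈ Finset.range (n + 1),
        (n.choose l : ℂ) * (-1) ^ l * ((1 + q) / (1 + w * q ^ l)) ^ r) := by
  obtain ⟨k, rfl⟩ : ∃ k, r = k + 1 := ⟨r - 1, by lia⟩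
  have geometric (l : ℕ) : HasSum (fun m : ℕ => ((m + k).choose k : ℂ) * (-(w * q ^ l)) ^ m)
      (1 / (1 + w * q ^ l) ^ (k + 1)) := by
    have norm_lt : ‖-(w * q ^ l)‖ < 1 := by
      rw [norm_neg, norm_mul, norm_pow]
      exact (mul_le_of_le_one_right (norm_nonneg w)
        (pow_le_one₀ (norm_nonneg q) hq1.le)).trans_lt hw
    simpa only [sub_neg_eq_add] using hasSum_choose_mul_geometric_of_norm_lt_one k norm_lt
  have termwise := (hasSum_sum fun l (_ : l ∈ Finset.range (n + 1)) =>
    (geometric l).mul_left ((n.choose l : ℂ) * (-1) ^ l * (1 + q) ^ (k + 1))).mul_left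
      (1 / (1 - q) ^ n)
  convert! termwise using 1
  · funext m
    rw [div_pow, one_sub_pow_eq_sum_choose (q ^ m) n, div_eq_mul_one_div, mul_comm _ (1 / _),
      mul_left_comm, Finset.mul_sum]
    congr 1
    refine Finset.sum_congr rfl fun l _ => ?_
    rw [show m + (k + 1) - 1 = m + k by lia, Nat.choose_symm_add, neg_pow (w * q ^ l), mul_pow,
      ← pow_mul, ← pow_mul, mul_comm l m]
    ring
  · congr 1
    refine Finset.sum_congr rfl fun l _ => ?_
    rw [div_pow]
    ring
end

section
/- Let r ≥ 1 and n ≥ 0 be integers, let q ∈ ℝ with 0 < q < 1, let w ∈ ℂ with |w| < 1, and let x ∈ ℝ with x ≥ 0. Then the series (1+q)^r · ∑_{m=0}^∞ C(m+r-1, m) (-1)^m w^m [m+x]_q^n converges, and its sum equals the finite sum (1/(1-q)^n) · ∑_{l=0}^n C(n,l) (-1)^l q^{l x} ((1+q)/(1+w q^l))^r. (This expresses the w-q-Euler polynomial of order r, E_{n,w,q}^{(r)}(x), as a convergent infinite series.) -/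
/-- The negative binomial series
`∑ C(m+r-1,m) (-1)^m z^m = 1 / (1 + z)^r`, scaled by `c^r`. -/
lemma hasSum_choose_mul_neg_pow (r : ℕ) (hr : 1 ≤ r) (c z : ℂ) (hz : ‖z‖ < 1) :
    HasSum (fun m : ℕ => c ^ r * ((m + r - 1).choose m : ℂ) * (-1) ^ m * z ^ m)
      ((c / (1 + z)) ^ r) := by
  obtain ⟨k, rfl⟩ : ∃ k, r = k + 1 := ⟨r - 1, by omega⟩
  have h := (hasSum_choose_mul_geometric_of_norm_lt_one k
    (r := -z) (by rwa [norm_neg])).mul_left (c ^ (k + 1))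
  convert! h using 1
  · funext m
    rw [← add_assoc, Nat.add_sub_cancel, Nat.choose_symm_add, neg_pow z m]
    ring
  · rw [sub_neg_eq_add, div_pow, mul_one_div]

/-- Binomial expansion of the `n`-th power of the `q`-number `[m + x]_q`. -/
lemma qNumber_pow_eq_sum (n m : ℕ) {q : ℝ} (hq : 0 < q) (x : ℝ) :
    ((((1 - q ^ ((m : ℝ) + x)) / (1 - q) : ℝ) : ℂ)) ^ n =
      (1 / ((1 : ℂ) - (q : ℂ)) ^ n) * ∑ l ∈ Finset.range (n + 1),
        (n.choose l : ℂ) * (-1) ^ l * ((q ^ ((l : ℝ) * x) : ℝ) : ℂ) * ((q : ℂ) ^ l) ^ m := by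
  have h : (1 - q ^ ((m : ℝ) + x)) ^ n = ∑ l ∈ Finset.range (n + 1),
      (n.choose l : ℝ) * (-1) ^ l * q ^ ((l : ℝ) * x) * (q ^ l) ^ m := by
    rw [sub_eq_neg_add, add_pow]
    refine Finset.sum_congr rfl fun l _ => ?_
    rw [Real.rpow_add hq, Real.rpow_natCast, neg_pow, mul_pow, mul_comm (l : ℝ) x,
      Real.rpow_mul_natCast hq.le, ← pow_mul, ← pow_mul, mul_comm m l, one_pow]
    ring
  rw [← Complex.ofReal_pow, div_pow, h]
  push_cast
  rw [div_eq_mul_one_div, mul_comm]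


/-- For integers `r ≥ 1`, `n ≥ 0`, real `0 < q < 1`, complex `|w| < 1` and
real `x ≥ 0`, the series `(1+q)^r ∑_{m=0}^∞ C(m+r-1,m) (-1)^m w^m [m+x]_q^n` converges to
`(1/(1-q)^n) ∑_{l=0}^n C(n,l) (-1)^l q^{l x} ((1+q)/(1+w q^l))^r`, where
`[y]_q = (1-q^y)/(1-q)` with `q^y` the real power `exp(y log q)`. -/
theorem stmt_1 (r n : ℕ) (hr : 1 ≤ r) (q : ℝ) (hq0 : 0 < q) (hq1 : q < 1)
    (w : ℂ) (hw : ‖w‖ < 1) (x : ℝ) (hx : 0 ≤ x) :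
    HasSum
      (fun m : ℕ => ((1 : ℂ) + (q : ℂ)) ^ r * ((m + r - 1).choose m : ℂ) * (-1) ^ m * w ^ m *
        ((((1 - q ^ ((m : ℝ) + x)) / (1 - q) : ℝ) : ℂ)) ^ n)
      ((1 / ((1 : ℂ) - (q : ℂ)) ^ n) * ∑ l ∈ Finset.range (n + 1),
        (n.choose l : ℂ) * (-1) ^ l * ((q ^ ((l : ℝ) * x) : ℝ) : ℂ) *
          (((1 : ℂ) + (q : ℂ)) / (1 + w * (q : ℂ) ^ l)) ^ r) := by
  have hsum := (hasSum_sum fun l (_ : l ∈ Finset.range (n + 1)) =>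
    (hasSum_choose_mul_neg_pow r hr (1 + (q : ℂ)) (w * (q : ℂ) ^ l) (by
      rw [norm_mul, norm_pow, Complex.norm_real, Real.norm_of_nonneg hq0.le]
      exact (mul_le_of_le_one_right (norm_nonneg w) (pow_le_one₀ hq0.le hq1.le)).trans_lt
        hw)).mul_left
      ((n.choose l : ℂ) * (-1) ^ l * ((q ^ ((l : ℝ) * x) : ℝ) : ℂ))).mul_left
    (1 / ((1 : ℂ) - (q : ℂ)) ^ n)
  convert! hsum using 1
  funext m
  rw [qNumber_pow_eq_sum n m hq0 x, mul_left_comm, Finset.mul_sum]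
  congr 1
  refine Finset.sum_congr rfl fun l _ => ?_
  rw [mul_pow w]
  ring
end

section
/- Let r ≥ 1 be an integer and let q, w ∈ ℂ with 0 < |q| < 1 and |w| < 1. Define E_n = (1+q)^r ∑_{m=0}^∞ C(m+r-1,m)(-1)^m w^m [m]_q^n for each n ≥ 0. Then for every t ∈ ℂ the series F(t) := (1+q)^r ∑_{m=0}^∞ C(m+r-1,m)(-1)^m w^m exp([m]_q · t) converges absolutely, and F(t) = ∑_{n=0}^∞ E_n t^n / n!, the latter series also converging for every t ∈ ℂ. -/
/-- If `c` is absolutely summable and `x` is bounded, then `∑ c m * exp (x m * t)` converges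
absolutely. -/
theorem summable_norm_mul_cexp {c x : ℕ → ℂ} (hc : Summable fun m => ‖c m‖) {B : ℝ}
    (hx : ∀ m, ‖x m‖ ≤ B) (t : ℂ) :
    Summable fun m => ‖c m * Complex.exp (x m * t)‖ := by
  refine (hc.mul_right (Real.exp (B * ‖t‖))).of_nonneg_of_le (fun _ => norm_nonneg _) fun m => ?_
  rw [norm_mul]
  gcongr
  refine (Complex.norm_exp_le_exp_norm _).trans (Real.exp_le_exp.2 ?_)
  rw [norm_mul]
  gcongr
  exact hx m

/-- The exponential generating function of the moments `∑ c m * x m ^ n` of an absolutely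
summable `c` at bounded nodes `x` is `∑ c m * exp (x m * t)`. -/
theorem hasSum_moment_mul_pow_div_factorial {c x : ℕ → ℂ} (hc : Summable fun m => ‖c m‖) {B : ℝ}
    (hx : ∀ m, ‖x m‖ ≤ B) (t : ℂ) :
    HasSum (fun n : ℕ => (∑' m, c m * x m ^ n) * t ^ n / (n.factorial : ℂ))
      (∑' m, c m * Complex.exp (x m * t)) := by
  have hs : Summable fun p : ℕ × ℕ => c p.1 * ((x p.1 * t) ^ p.2 / (p.2.factorial : ℂ)) := by
    have hB : 0 ≤ B := (norm_nonneg _).trans (hx 0)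
    refine Summable.of_norm_bounded (hc.mul_of_nonneg
      (Real.summable_pow_div_factorial (B * ‖t‖)) (fun _ => norm_nonneg _)
      fun n => by positivity) fun p => ?_
    rw [norm_mul, norm_div, norm_pow, norm_mul, Complex.norm_natCast]
    gcongr
    exact hx p.1
  have hrow (m : ℕ) : HasSum (fun n : ℕ => c m * ((x m * t) ^ n / (n.factorial : ℂ)))
      (c m * Complex.exp (x m * t)) := by
    rw [Complex.exp_eq_exp_ℂ]
    exact (NormedSpace.expSeries_div_hasSum_exp (x m * t)).mul_left (c m)
  rw [(hs.hasSum.prod_fiberwise hrow).tsum_eq]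
  have hswap := (Equiv.prodComm ℕ ℕ).hasSum_iff.2 hs.hasSum
  refine (hswap.prod_fiberwise fun n => (hswap.summable.prod_factor n).hasSum).congr_fun ?_
  intro n
  rw [mul_div_assoc, ← tsum_mul_right]
  refine tsum_congr fun m => ?_
  simp only [Function.comp_apply, Equiv.prodComm_apply, Prod.swap_prod_mk, mul_pow]
  ring

/-- The binomial series `∑ C(m+r-1,m) (-w)^m` converges absolutely for `‖w‖ < 1`. -/
theorem summable_norm_choose_mul_neg_one_pow_mul_pow {r : ℕ} (hr : 1 ≤ r) {w : ℂ}
    (hw : ‖w‖ < 1) :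
    Summable fun m : ℕ => ‖((m + r - 1).choose m : ℂ) * (-1) ^ m * w ^ m‖ := by
  obtain ⟨k, rfl⟩ := Nat.exists_eq_add_of_le' hr
  refine (summable_choose_mul_geometric_of_norm_lt_one k (r := ‖w‖) (by simpa using hw)).congr
    fun m => ?_
  rw [Nat.add_succ_sub_one, Nat.choose_symm_add]
  simp

/-- The `q`-integers are bounded when `‖q‖ < 1`. -/
theorem norm_one_sub_pow_div_one_sub_le {q : ℂ} (hq : ‖q‖ < 1) (m : ℕ) :
    ‖(1 - q ^ m) / (1 - q)‖ ≤ 2 / ‖1 - q‖ := by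
  rw [norm_div]
  gcongr
  calc ‖1 - q ^ m‖ ≤ ‖(1 : ℂ)‖ + ‖q ^ m‖ := norm_sub_le _ _
    _ ≤ 1 + 1 := by
      rw [norm_one, norm_pow]
      gcongr
      exact pow_le_one₀ (norm_nonneg q) hq.le
    _ = 2 := by norm_num

/-- For an integer `r ≥ 1` and complex `q, w` with `0 < |q| < 1`, `|w| < 1`,
let `E n = (1+q)^r ∑_{m=0}^∞ C(m+r-1,m)(-1)^m w^m [m]_q^n`. Then for every `t ∈ ℂ` the
series `F(t) = (1+q)^r ∑_{m=0}^∞ C(m+r-1,m)(-1)^m w^m exp([m]_q t)` converges absolutely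
and `F(t) = ∑_{n=0}^∞ E n · t^n/n!`, the latter series converging for every `t`. -/
theorem stmt_2 (r : ℕ) (hr : 1 ≤ r) (q w : ℂ)
    (hq0 : 0 < ‖q‖) (hq1 : ‖q‖ < 1) (hw : ‖w‖ < 1)
    (E : ℕ → ℂ)
    (hE : ∀ n : ℕ, E n = (1 + q) ^ r * ∑' m : ℕ,
      ((m + r - 1).choose m : ℂ) * (-1) ^ m * w ^ m * ((1 - q ^ m) / (1 - q)) ^ n) :
    ∀ t : ℂ,
      Summable (fun m : ℕ => ‖(1 + q) ^ r * ((m + r - 1).choose m : ℂ) * (-1) ^ m * w ^ m *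
        Complex.exp (((1 - q ^ m) / (1 - q)) * t)‖) ∧
      HasSum (fun n : ℕ => E n * t ^ n / (n.factorial : ℂ))
        ((1 + q) ^ r * ∑' m : ℕ, ((m + r - 1).choose m : ℂ) * (-1) ^ m * w ^ m *
          Complex.exp (((1 - q ^ m) / (1 - q)) * t)) := by
  intro t
  have hc := summable_norm_choose_mul_neg_one_pow_mul_pow hr hw
  have hx := norm_one_sub_pow_div_one_sub_le hq1
  constructor
  · refine ((summable_norm_mul_cexp hc hx t).mul_left ‖(1 + q) ^ r‖).congr fun m => ?_
    rw [← norm_mul]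
    simp only [mul_assoc]
  · refine ((hasSum_moment_mul_pow_div_factorial hc hx t).mul_left ((1 + q) ^ r)).congr_fun ?_
    intro n
    rw [hE n]
    ring
end

section
/- Let r ≥ 1 be an integer, let q ∈ ℝ with 0 < q < 1, let w ∈ ℂ with |w| < 1, and let x ∈ ℝ with x ≥ 0. Define F_x : ℂ → ℂ by F_x(t) = (1+q)^r ∑_{m=0}^∞ C(m+r-1,m)(-1)^m w^m exp([m+x]_q · t), and set G_x(t) = t^r · F_x(t). Then the k-th iterated derivative of G_x at t = 0 vanishes for every k with 0 ≤ k ≤ r-1, and for every n ≥ 0 the (n+r)-th iterated derivative of G_x at t = 0 equals r! · C(n+r, r) · E_n(x), where E_n(x) = (1+q)^r ∑_{m=0}^∞ C(m+r-1,m)(-1)^m w^m [m+x]_q^n. -/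
section ExponentialSeries

variable {a c : ℕ → ℂ} {B : ℝ}

theorem summable_norm_mul_of_norm_le (ha : Summable fun m => ‖a m‖) (hc : ∀ m, ‖c m‖ ≤ B) :
    Summable fun m => ‖a m * c m‖ :=
  .of_nonneg_of_le (fun _ => norm_nonneg _)
    (fun m => by
      rw [norm_mul]
      exact mul_le_mul_of_nonneg_left (hc m) (norm_nonneg _))
    (ha.mul_right B)

theorem hasDerivAt_tsum_mul_cexp (ha : Summable fun m => ‖a m‖) (hc : ∀ m, ‖c m‖ ≤ B) (t : ℂ) :
    HasDerivAt (fun t => ∑' m, a m * Complex.exp (c m * t))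
      (∑' m, a m * c m * Complex.exp (c m * t)) t := by
  have hR : 0 < ‖t‖ + 1 := by positivity
  refine hasDerivAt_tsum_of_isPreconnected
    (g := fun m t => a m * Complex.exp (c m * t))
    (g' := fun m t => a m * c m * Complex.exp (c m * t))
    (u := fun m => ‖a m * c m‖ * Real.exp (B * (‖t‖ + 1)))
    (t := Metric.ball (0 : ℂ) (‖t‖ + 1)) (y₀ := 0)
    ((summable_norm_mul_of_norm_le ha hc).mul_right _) Metric.isOpen_ball
    (convex_ball _ _).isPreconnected (fun m y _ => ?_) (fun m y hy => ?_)
    (Metric.mem_ball_self hR) ?_ (mem_ball_zero_iff.2 (lt_add_one ‖t‖))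
  · have h := (((hasDerivAt_id y).const_mul (c m)).cexp).const_mul (a m)
    convert! h using 1
    simp only [id, mul_one]
    ring
  · rw [norm_mul]
    gcongr
    refine (Complex.norm_exp_le_exp_norm _).trans (Real.exp_le_exp.2 ?_)
    rw [norm_mul]
    exact mul_le_mul (hc m) (mem_ball_zero_iff.1 hy).le (norm_nonneg _)
      ((norm_nonneg _).trans (hc m))
  · simpa using ha.of_norm

theorem contDiff_tsum_mul_cexp (ha : Summable fun m => ‖a m‖) (hc : ∀ m, ‖c m‖ ≤ B)
    {n : WithTop ℕ∞} : ContDiff ℂ n fun t => ∑' m, a m * Complex.exp (c m * t) :=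
  Differentiable.contDiff fun t => (hasDerivAt_tsum_mul_cexp ha hc t).differentiableAt

theorem iteratedDeriv_tsum_mul_cexp (ha : Summable fun m => ‖a m‖) (hc : ∀ m, ‖c m‖ ≤ B) (n : ℕ) :
    iteratedDeriv n (fun t => ∑' m, a m * Complex.exp (c m * t)) =
      fun t => ∑' m, a m * c m ^ n * Complex.exp (c m * t) := by
  induction n generalizing a with
  | zero => simp
  | succ n ih =>
    rw [iteratedDeriv_succ', funext fun t => (hasDerivAt_tsum_mul_cexp ha hc t).deriv,
      ih (summable_norm_mul_of_norm_le ha hc)]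
    simp only [pow_succ', mul_assoc]

end ExponentialSeries

theorem iteratedDeriv_pow_mul_zero {f : ℂ → ℂ} {r k : ℕ} (hf : ContDiff ℂ k f) :
    iteratedDeriv k (fun t => t ^ r * f t) 0 =
      if r ≤ k then (k.choose r : ℂ) * r.factorial * iteratedDeriv (k - r) f 0 else 0 := by
  rw [iteratedDeriv_fun_mul (contDiff_fun_id.pow r).contDiffAt hf.contDiffAt]
  simp [iteratedDeriv_fun_pow_zero, -iteratedDeriv_pow]

theorem norm_qNumber_le {q y : ℝ} (hq0 : 0 < q) (hq1 : q < 1) (hy : 0 ≤ y) :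
    ‖(((1 - q ^ y) / (1 - q) : ℝ) : ℂ)‖ ≤ 1 / (1 - q) := by
  have h1 : q ^ y ≤ 1 := Real.rpow_le_one hq0.le hq1.le hy
  have h0 : 0 < q ^ y := Real.rpow_pos_of_pos hq0 y
  have hq : 0 < 1 - q := sub_pos.2 hq1
  rw [Complex.norm_real, Real.norm_of_nonneg (div_nonneg (sub_nonneg.2 h1) hq.le)]
  gcongr
  linarith

/-- For an integer `r ≥ 1`, real `0 < q < 1`, complex `|w| < 1` and real
`x ≥ 0`, let `F_x(t) = (1+q)^r ∑_{m=0}^∞ C(m+r-1,m)(-1)^m w^m exp([m+x]_q t)` and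
`G_x(t) = t^r F_x(t)`, where `[y]_q = (1-q^y)/(1-q)` with `q^y` the real power. Then
`iteratedDeriv k G_x 0 = 0` for `0 ≤ k ≤ r-1`, and for every `n ≥ 0`,
`iteratedDeriv (n+r) G_x 0 = r! · C(n+r,r) · E n x` where
`E n x = (1+q)^r ∑_{m=0}^∞ C(m+r-1,m)(-1)^m w^m [m+x]_q^n`. -/
theorem stmt_5 (r : ℕ) (hr : 1 ≤ r) (q : ℝ) (hq0 : 0 < q) (hq1 : q < 1)
    (w : ℂ) (hw : ‖w‖ < 1) (x : ℝ) (hx : 0 ≤ x)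
    (F G : ℂ → ℂ)
    (hF : ∀ t : ℂ, F t = ((1 : ℂ) + (q : ℂ)) ^ r * ∑' m : ℕ,
      ((m + r - 1).choose m : ℂ) * (-1) ^ m * w ^ m *
        Complex.exp ((((1 - q ^ ((m : ℝ) + x)) / (1 - q) : ℝ) : ℂ) * t))
    (hG : ∀ t : ℂ, G t = t ^ r * F t) :
    (∀ k : ℕ, k ≤ r - 1 → iteratedDeriv k G 0 = 0) ∧
    (∀ n : ℕ, iteratedDeriv (n + r) G 0 =
      (r.factorial : ℂ) * ((n + r).choose r : ℂ) *
        (((1 : ℂ) + (q : ℂ)) ^ r * ∑' m : ℕ,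
          ((m + r - 1).choose m : ℂ) * (-1) ^ m * w ^ m *
            ((((1 - q ^ ((m : ℝ) + x)) / (1 - q) : ℝ) : ℂ)) ^ n)) := by
  have ha := summable_norm_choose_mul_neg_one_pow_mul_pow hr hw
  have hc (m : ℕ) := norm_qNumber_le hq0 hq1 (add_nonneg m.cast_nonneg hx)
  have hFD {n : WithTop ℕ∞} : ContDiff ℂ n F := by
    rw [funext hF]
    exact contDiff_const.mul (contDiff_tsum_mul_cexp ha hc)
  rw [funext hG]
  refine ⟨fun k hk => ?_, fun n => ?_⟩
  · rw [iteratedDeriv_pow_mul_zero hFD, if_neg (by lia)]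
  · rw [iteratedDeriv_pow_mul_zero hFD, if_pos (by lia), Nat.add_sub_cancel, funext hF,
      iteratedDeriv_const_mul_field, iteratedDeriv_tsum_mul_cexp ha hc]
    simp only [mul_zero, Complex.exp_zero, mul_one]
    ring
end

section
/- Let r ≥ 1 be an integer, let q ∈ ℝ with 0 < q < 1, and let w ∈ ℂ with |w| < 1. For s ∈ ℂ define the Lerch-type q-zeta function of order r by ζ_{q,w}^{(r)}(s) = (1+q)^r ∑_{m=1}^∞ C(m+r-1,m)(-1)^m w^m [m]_q^{-s}, where [m]_q^{-s} = exp(-s · log [m]_q) (note [m]_q > 0 for m ≥ 1). Then for every s ∈ ℂ this series converges, the function ζ_{q,w}^{(r)} is entire (complex differentiable on all of ℂ), and for every integer k ≥ 1 one has ζ_{q,w}^{(r)}(-k) = (1/(1-q)^k) ∑_{l=0}^k C(k,l)(-1)^l ((1+q)/(1+w q^l))^r, i.e. ζ_{q,w}^{(r)}(-k) = E_{k,w,q}^{(r)}. -/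
/-- The `q`-analogue `[m + 1]_q` of a positive integer is at least `1`. -/
lemma one_le_qAnalogue_succ {q : ℝ} (hq0 : 0 < q) (hq1 : q < 1) (m : ℕ) :
    1 ≤ (1 - q ^ (m + 1)) / (1 - q) := by
  rw [one_le_div (by linarith)]
  have : q ^ (m + 1) ≤ q := pow_le_of_le_one hq0.le hq1.le (Nat.succ_ne_zero m)
  linarith

lemma norm_exp_neg_mul_log_qAnalogue_le {q : ℝ} (hq0 : 0 < q) (hq1 : q < 1) (m : ℕ) (s : ℂ) :
    ‖Complex.exp (-s * (Real.log ((1 - q ^ (m + 1)) / (1 - q)) : ℂ))‖ ≤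
      Real.exp (‖s‖ * Real.log (1 / (1 - q))) := by
  have h1 := one_le_qAnalogue_succ hq0 hq1 m
  have hle : (1 - q ^ (m + 1)) / (1 - q) ≤ 1 / (1 - q) := by
    have : 0 < q ^ (m + 1) := by positivity
    exact div_le_div_of_nonneg_right (by linarith) (by linarith)
  have hlog := Real.log_le_log (by linarith) hle
  refine (Complex.norm_exp_le_exp_norm _).trans (Real.exp_le_exp.mpr ?_)
  rw [norm_mul, norm_neg, Complex.norm_real, Real.norm_of_nonneg (Real.log_nonneg h1)]
  gcongr

/-- The negative binomial coefficients against a `k`-th power of `q`-analogues, summed over all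
`n : ℕ`. -/
lemma hasSum_choose_mul_qAnalogue_pow (d k : ℕ) {q w : ℂ} (hq : ‖q‖ ≤ 1) (hw : ‖w‖ < 1) :
    HasSum (fun n : ℕ => ((n + d).choose d : ℂ) * (-w) ^ n * ((1 - q ^ n) / (1 - q)) ^ k)
      ((1 / (1 - q) ^ k) * ∑ l ∈ Finset.range (k + 1),
        (k.choose l : ℂ) * (-1) ^ l * (1 / (1 + w * q ^ l) ^ (d + 1))) := by
  have hterm (l : ℕ) : HasSum (fun n : ℕ => ((n + d).choose d : ℂ) * (-w * q ^ l) ^ n)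
      (1 / (1 + w * q ^ l) ^ (d + 1)) := by
    have hlt : ‖-w * q ^ l‖ < 1 := by
      rw [norm_mul, norm_neg, norm_pow]
      exact (mul_le_of_le_one_right (norm_nonneg _) (pow_le_one₀ (norm_nonneg _) hq)).trans_lt hw
    simpa only [neg_mul, sub_neg_eq_add] using hasSum_choose_mul_geometric_of_norm_lt_one d hlt
  have hsum := (hasSum_sum fun l (_ : l ∈ Finset.range (k + 1)) =>
    (hterm l).mul_left ((k.choose l : ℂ) * (-1) ^ l)).mul_left (1 / (1 - q) ^ k)
  refine hsum.congr_fun fun n => ?_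
  have hbinom : (1 - q ^ n) ^ k =
      ∑ l ∈ Finset.range (k + 1), (k.choose l : ℂ) * (-1) ^ l * (q ^ l) ^ n := by
    rw [show (1 : ℂ) - q ^ n = -q ^ n + 1 by ring, add_pow]
    refine Finset.sum_congr rfl fun l _ => ?_
    rw [neg_pow (q ^ n) l]
    ring
  rw [div_pow, hbinom, Finset.sum_div, Finset.mul_sum, Finset.mul_sum]
  refine Finset.sum_congr rfl fun l _ => ?_
  rw [mul_pow]
  ring

/-- For an integer `r ≥ 1`, real `0 < q < 1` and complex `|w| < 1`, the
Lerch-type q-zeta function of order `r`,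
`ζ(s) = (1+q)^r ∑_{m=1}^∞ C(m+r-1,m)(-1)^m w^m [m]_q^{-s}`
(with `[m]_q^{-s} = exp(-s log [m]_q)` and `[m]_q = (1-q^m)/(1-q) > 0`), has a convergent
defining series for every `s ∈ ℂ`, is entire, and satisfies, for every integer `k ≥ 1`,
`ζ(-k) = (1/(1-q)^k) ∑_{l=0}^k C(k,l)(-1)^l ((1+q)/(1+w q^l))^r = E_{k,w,q}^{(r)}`.
(Here the sum over `m ≥ 1` is written as a sum over `m : ℕ` of the term at `m+1`.) -/
theorem stmt_6 (r : ℕ) (hr : 1 ≤ r) (q : ℝ) (hq0 : 0 < q) (hq1 : q < 1)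
    (w : ℂ) (hw : ‖w‖ < 1)
    (zeta : ℂ → ℂ)
    (hzeta : ∀ s : ℂ, zeta s = ((1 : ℂ) + (q : ℂ)) ^ r * ∑' m : ℕ,
      (((m + 1) + r - 1).choose (m + 1) : ℂ) * (-1) ^ (m + 1) * w ^ (m + 1) *
        Complex.exp (-s * (Real.log ((1 - q ^ (m + 1)) / (1 - q)) : ℂ))) :
    (∀ s : ℂ, Summable (fun m : ℕ =>
      (((m + 1) + r - 1).choose (m + 1) : ℂ) * (-1) ^ (m + 1) * w ^ (m + 1) *
        Complex.exp (-s * (Real.log ((1 - q ^ (m + 1)) / (1 - q)) : ℂ)))) ∧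
    Differentiable ℂ zeta ∧
    (∀ k : ℕ, 1 ≤ k → zeta (-(k : ℂ)) =
      (1 / ((1 : ℂ) - (q : ℂ)) ^ k) * ∑ l ∈ Finset.range (k + 1),
        (k.choose l : ℂ) * (-1) ^ l *
          (((1 : ℂ) + (q : ℂ)) / (1 + w * (q : ℂ) ^ l)) ^ r) := by
  obtain ⟨d, rfl⟩ : ∃ d, r = d + 1 := ⟨r - 1, by omega⟩
  have hchoose (m : ℕ) : ((m + 1) + (d + 1) - 1).choose (m + 1) = (m + 1 + d).choose d := by
    rw [show (m + 1) + (d + 1) - 1 = (m + 1) + d by omega, Nat.choose_symm_add]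
  have hcoeff : Summable fun m : ℕ =>
      ‖(((m + 1) + (d + 1) - 1).choose (m + 1) : ℂ) * (-1) ^ (m + 1) * w ^ (m + 1)‖ := by
    have h := (summable_nat_add_iff 1).mpr
      (summable_choose_mul_geometric_of_norm_lt_one d (r := ‖w‖) (by simpa using hw))
    refine h.congr fun m => ?_
    rw [hchoose]
    simp
  have hbound {R : ℝ} {s : ℂ} (hs : ‖s‖ ≤ R) (m : ℕ) :
      ‖(((m + 1) + (d + 1) - 1).choose (m + 1) : ℂ) * (-1) ^ (m + 1) * w ^ (m + 1) *
        Complex.exp (-s * (Real.log ((1 - q ^ (m + 1)) / (1 - q)) : ℂ))‖ ≤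
      ‖(((m + 1) + (d + 1) - 1).choose (m + 1) : ℂ) * (-1) ^ (m + 1) * w ^ (m + 1)‖ *
        Real.exp (R * Real.log (1 / (1 - q))) := by
    rw [norm_mul]
    refine mul_le_mul_of_nonneg_left
      ((norm_exp_neg_mul_log_qAnalogue_le hq0 hq1 m s).trans ?_) (norm_nonneg _)
    have : 0 ≤ Real.log (1 / (1 - q)) :=
      Real.log_nonneg (by rw [one_le_div (by linarith)]; linarith)
    gcongr
  refine ⟨fun s => .of_norm_bounded (hcoeff.mul_right _) (hbound le_rfl), ?_, fun k hk => ?_⟩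
  · rw [funext hzeta]
    refine Differentiable.const_mul (fun s => ?_) _
    refine (Complex.differentiableOn_tsum_of_summable_norm (U := Metric.ball 0 (‖s‖ + 1))
      (hcoeff.mul_right (Real.exp ((‖s‖ + 1) * Real.log (1 / (1 - q)))))
      (fun m => Differentiable.differentiableOn (by fun_prop)) Metric.isOpen_ball
      fun m z hz => hbound (by simpa using (mem_ball_zero_iff.mp hz).le) m).differentiableAt ?_
    exact Metric.isOpen_ball.mem_nhds (by simp)
  · have hfull := hasSum_choose_mul_qAnalogue_pow d k (q := (q : ℂ)) (w := w)
      (by rw [Complex.norm_real, Real.norm_of_nonneg hq0.le]; exact hq1.le) hw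
    have hshift := (hasSum_nat_add_iff' 1).mpr hfull
    have hk0 : k ≠ 0 := by omega
    simp only [Finset.range_one, Finset.sum_singleton, pow_zero, sub_self, zero_div,
      zero_pow hk0, mul_zero, sub_zero] at hshift
    have hterm (m : ℕ) : (((m + 1) + (d + 1) - 1).choose (m + 1) : ℂ) * (-1) ^ (m + 1) *
        w ^ (m + 1) *
        Complex.exp (-(-(k : ℂ)) * (Real.log ((1 - q ^ (m + 1)) / (1 - q)) : ℂ)) =
        ((m + 1 + d).choose d : ℂ) * (-w) ^ (m + 1) *
          ((1 - (q : ℂ) ^ (m + 1)) / (1 - (q : ℂ))) ^ k := by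
      have hpos := zero_lt_one.trans_le (one_le_qAnalogue_succ hq0 hq1 m)
      rw [hchoose, neg_neg, Complex.exp_nat_mul, ← Complex.ofReal_exp, Real.exp_log hpos,
        neg_pow w]
      push_cast
      ring
    rw [hzeta, tsum_congr hterm, hshift.tsum_eq, mul_left_comm, Finset.mul_sum]
    congr 1
    refine Finset.sum_congr rfl fun l _ => ?_
    rw [div_pow]
    ring
end

section
/- Let r ≥ 1 be an integer, let q ∈ ℝ with 0 < q < 1, let w ∈ ℂ with |w| < 1, and let x ∈ ℝ with x > 0. For s ∈ ℂ define the Hurwitz–Lerch-type q-zeta function of order r by ζ_{q,w}^{(r)}(s, x) = (1+q)^r ∑_{m=0}^∞ C(m+r-1,m)(-1)^m w^m [m+x]_q^{-s}, where [m+x]_q^{-s} = exp(-s · log [m+x]_q) (note [m+x]_q > 0 for m ≥ 0 and x > 0). Then for every s ∈ ℂ this series converges, and for every integer k ≥ 1 one has ζ_{q,w}^{(r)}(-k, x) = (1/(1-q)^k) ∑_{l=0}^k C(k,l)(-1)^l q^{l x} ((1+q)/(1+w q^l))^r, i.e. ζ_{q,w}^{(r)}(-k,x) = E_{k,w,q}^{(r)}(x).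 -/
/-- The negative binomial series `∑ C(m+d,m) (-1)^m z^m = (1+z)^{-(d+1)}` on the unit disc. -/
lemma hasSum_choose_mul_neg_one_pow_mul_pow (d : ℕ) {z : ℂ} (hz : ‖z‖ < 1) :
    HasSum (fun m : ℕ => ((m + d).choose m : ℂ) * (-1) ^ m * z ^ m) (1 / (1 + z) ^ (d + 1)) := by
  have h := hasSum_choose_mul_geometric_of_norm_lt_one (𝕜 := ℂ) d (r := -z) (by simpa using hz)
  rw [sub_neg_eq_add] at h
  refine h.congr_fun fun m => ?_
  rw [Nat.choose_symm_add, neg_pow z m, mul_assoc]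

/-- `|log [m+x]_q|` is bounded uniformly in `m`. -/
lemma exists_abs_log_qNumber_le {q : ℝ} (hq0 : 0 < q) (hq1 : q < 1) {x : ℝ} (hx : 0 < x) :
    ∃ B : ℝ, ∀ m : ℕ, |Real.log ((1 - q ^ ((m : ℝ) + x)) / (1 - q))| ≤ B := by
  have h1q : 0 < 1 - q := by linarith
  have hqx : q ^ x < 1 := Real.rpow_lt_one hq0.le hq1 hx
  refine ⟨max |Real.log ((1 - q ^ x) / (1 - q))| |Real.log (1 / (1 - q))|, fun m => ?_⟩
  have hle : q ^ ((m : ℝ) + x) ≤ q ^ x :=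
    Real.rpow_le_rpow_of_exponent_ge hq0 hq1.le (by linarith [m.cast_nonneg (α := ℝ)])
  have hpos : 0 < q ^ ((m : ℝ) + x) := Real.rpow_pos_of_pos hq0 _
  refine abs_le_max_abs_abs (Real.log_le_log (div_pos (by linarith) h1q) ?_)
    (Real.log_le_log (div_pos (by linarith) h1q) ?_)
  · gcongr
  · gcongr
    linarith

/-- The binomial expansion of `[m+x]_q ^ k`. -/
lemma exp_mul_log_qNumber {q : ℝ} (hq0 : 0 < q) (hq1 : q < 1) {x : ℝ} (hx : 0 < x) (k m : ℕ) :
    Complex.exp (k * (Real.log ((1 - q ^ ((m : ℝ) + x)) / (1 - q)) : ℂ)) =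
      (1 / ((1 : ℂ) - (q : ℂ)) ^ k) * ∑ l ∈ Finset.range (k + 1),
        (k.choose l : ℂ) * (-1) ^ l * ((q ^ ((l : ℝ) * x) : ℝ) : ℂ) * ((q : ℂ) ^ l) ^ m := by
  have hlt : q ^ ((m : ℝ) + x) < 1 := Real.rpow_lt_one hq0.le hq1 (by positivity)
  have hpos : 0 < (1 - q ^ ((m : ℝ) + x)) / (1 - q) := div_pos (by linarith) (by linarith)
  rw [Complex.exp_nat_mul, ← Complex.ofReal_exp, Real.exp_log hpos, Complex.ofReal_div, div_pow,
    div_eq_mul_one_div, mul_comm]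
  push_cast
  congr 1
  rw [sub_eq_neg_add, add_pow]
  refine Finset.sum_congr rfl fun l _ => ?_
  have hexp : (q ^ ((m : ℝ) + x)) ^ l = q ^ ((l : ℝ) * x) * (q ^ l) ^ m := by
    rw [← Real.rpow_natCast, ← Real.rpow_mul hq0.le, ← pow_mul, ← Real.rpow_natCast q (l * m),
      ← Real.rpow_add hq0]
    congr 1
    push_cast
    ring
  have hexp' : (((q ^ ((m : ℝ) + x) : ℝ) : ℂ)) ^ l =
      ((q ^ ((l : ℝ) * x) : ℝ) : ℂ) * ((q : ℂ) ^ l) ^ m := by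
    exact_mod_cast congrArg (fun t : ℝ => (t : ℂ)) hexp
  rw [neg_pow, hexp', one_pow]
  ring

/-- For an integer `r ≥ 1`, real `0 < q < 1`, complex `|w| < 1` and real
`x > 0`, the Hurwitz–Lerch-type q-zeta function of order `r`,
`ζ(s,x) = (1+q)^r ∑_{m=0}^∞ C(m+r-1,m)(-1)^m w^m [m+x]_q^{-s}`
(with `[m+x]_q^{-s} = exp(-s log [m+x]_q)`, `[y]_q = (1-q^y)/(1-q) > 0`, `q^y` the real
power), has a convergent defining series for every `s ∈ ℂ` and satisfies, for every
integer `k ≥ 1`,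
`ζ(-k,x) = (1/(1-q)^k) ∑_{l=0}^k C(k,l)(-1)^l q^{l x} ((1+q)/(1+w q^l))^r`. -/
theorem stmt_7 (r : ℕ) (hr : 1 ≤ r) (q : ℝ) (hq0 : 0 < q) (hq1 : q < 1)
    (w : ℂ) (hw : ‖w‖ < 1) (x : ℝ) (hx : 0 < x)
    (zeta : ℂ → ℂ)
    (hzeta : ∀ s : ℂ, zeta s = ((1 : ℂ) + (q : ℂ)) ^ r * ∑' m : ℕ,
      ((m + r - 1).choose m : ℂ) * (-1) ^ m * w ^ m *
        Complex.exp (-s * (Real.log ((1 - q ^ ((m : ℝ) + x)) / (1 - q)) : ℂ))) :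
    (∀ s : ℂ, Summable (fun m : ℕ =>
      ((m + r - 1).choose m : ℂ) * (-1) ^ m * w ^ m *
        Complex.exp (-s * (Real.log ((1 - q ^ ((m : ℝ) + x)) / (1 - q)) : ℂ)))) ∧
    (∀ k : ℕ, 1 ≤ k → zeta (-(k : ℂ)) =
      (1 / ((1 : ℂ) - (q : ℂ)) ^ k) * ∑ l ∈ Finset.range (k + 1),
        (k.choose l : ℂ) * (-1) ^ l * ((q ^ ((l : ℝ) * x) : ℝ) : ℂ) *
          (((1 : ℂ) + (q : ℂ)) / (1 + w * (q : ℂ) ^ l)) ^ r) := by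
  obtain ⟨d, rfl⟩ : ∃ d, r = d + 1 := ⟨r - 1, by omega⟩
  simp only [Nat.add_sub_cancel, ← add_assoc] at hzeta ⊢
  constructor
  · intro s
    obtain ⟨B, hB⟩ := exists_abs_log_qNumber_le hq0 hq1 hx
    refine Summable.of_norm_bounded
      (((hasSum_choose_mul_neg_one_pow_mul_pow d hw).summable.norm).mul_right
        (Real.exp (‖s‖ * B))) fun m => ?_
    rw [norm_mul]
    gcongr
    refine (Complex.norm_exp_le_exp_norm _).trans (Real.exp_le_exp.mpr ?_)
    rw [norm_mul, norm_neg, Complex.norm_real, Real.norm_eq_abs]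
    gcongr
    exact hB m
  · intro k _
    have hterm : ∀ l : ℕ, HasSum (fun m : ℕ => (k.choose l : ℂ) * (-1) ^ l *
        ((q ^ ((l : ℝ) * x) : ℝ) : ℂ) *
          (((m + d).choose m : ℂ) * (-1) ^ m * (w * (q : ℂ) ^ l) ^ m))
        ((k.choose l : ℂ) * (-1) ^ l * ((q ^ ((l : ℝ) * x) : ℝ) : ℂ) *
          (1 / (1 + w * (q : ℂ) ^ l) ^ (d + 1))) := fun l => by
      refine (hasSum_choose_mul_neg_one_pow_mul_pow d ?_).mul_left _
      rw [norm_mul, norm_pow, Complex.norm_real, Real.norm_of_nonneg hq0.le]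
      exact (mul_le_of_le_one_right (norm_nonneg w) (pow_le_one₀ hq0.le hq1.le)).trans_lt hw
    have hsum := (hasSum_sum fun l (_ : l ∈ Finset.range (k + 1)) => hterm l).mul_left
      (1 / ((1 : ℂ) - (q : ℂ)) ^ k)
    rw [hzeta, neg_neg, tsum_congr fun m => ?_, hsum.tsum_eq, mul_left_comm, Finset.mul_sum]
    · congr 1
      refine Finset.sum_congr rfl fun l _ => ?_
      rw [div_pow]
      ring
    · rw [exp_mul_log_qNumber hq0 hq1 hx, mul_left_comm, Finset.mul_sum]
      congr 1
      refine Finset.sum_congr rfl fun l _ => ?_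
      rw [mul_pow w]
      ring
end

section
/- Let p be an odd prime, let q ∈ ℚ_p with ‖q - 1‖_p < 1, and let f : ℤ_p → ℚ_p be continuous. For N ≥ 1 set S_N(f) = ((1+q)/(1+q^{p^N})) · ∑_{x=0}^{p^N - 1} f(x) (-q)^x, where the natural number x is regarded as an element of ℤ_p (note ‖q^{p^N} - 1‖_p < 1, so 1 + q^{p^N} ≠ 0 since p is odd). Then the sequence N ↦ q · S_N(x ↦ f(x+1)) + S_N(f) converges, as N → ∞, to (1+q) · f(0). -/
theorem Padic.norm_le_one_of_norm_sub_one_lt_one {p : ℕ} [Fact p.Prime] {a : ℚ_[p]}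
    (ha : ‖a - 1‖ < 1) : ‖a‖ ≤ 1 := by
  have h := Padic.nonarchimedean (a - 1) 1
  rwa [sub_add_cancel, norm_one, max_eq_right ha.le] at h

theorem Padic.norm_pow_sub_one_lt_one {p : ℕ} [Fact p.Prime] {q : ℚ_[p]} (hq : ‖q - 1‖ < 1)
    (n : ℕ) : ‖q ^ n - 1‖ < 1 := by
  have hq1 : ‖q‖ ≤ 1 := Padic.norm_le_one_of_norm_sub_one_lt_one hq
  induction n with
  | zero => simp
  | succ n ih =>
    have h : q ^ (n + 1) - 1 = q ^ n * (q - 1) + (q ^ n - 1) := by ring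
    rw [h]
    refine (Padic.nonarchimedean _ _).trans_lt (max_lt ?_ ih)
    rw [norm_mul, norm_pow]
    exact (mul_le_of_le_one_left (norm_nonneg _) (pow_le_one₀ (norm_nonneg _) hq1)).trans_lt hq

theorem Padic.norm_one_add_of_norm_sub_one_lt_one {p : ℕ} [hp : Fact p.Prime] (hodd : p ≠ 2)
    {a : ℚ_[p]} (ha : ‖a - 1‖ < 1) : ‖1 + a‖ = 1 := by
  have h2 : ‖(2 : ℚ_[p])‖ = 1 := by
    have h : ‖((2 : ℕ) : ℚ_[p])‖ = 1 :=
      Padic.norm_natCast_eq_one_iff.mpr ((Nat.coprime_primes hp.out Nat.prime_two).mpr hodd)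
    exact_mod_cast h
  have h : 1 + a = 2 + (a - 1) := by ring
  rw [h, Padic.add_eq_max_of_ne (by rw [h2]; exact ha.ne'), h2, max_eq_left ha.le]

theorem mul_sum_range_shift_add_sum_range {R : Type*} [CommRing R] (q : R) (g : ℕ → R) (n : ℕ) :
    q * ∑ x ∈ Finset.range n, g (x + 1) * (-q) ^ x + ∑ x ∈ Finset.range n, g x * (-q) ^ x =
      g 0 - g n * (-q) ^ n := by
  induction n with
  | zero => simp
  | succ n ih =>
    rw [Finset.sum_range_succ, Finset.sum_range_succ]
    linear_combination ih


/-- Let `p` be an odd prime, `q ∈ ℚ_p` with `‖q-1‖_p < 1`, and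
`f : ℤ_p → ℚ_p` continuous. With
`S_N(f) = ((1+q)/(1+q^{p^N})) ∑_{x=0}^{p^N-1} f(x)(-q)^x`, the sequence
`N ↦ q · S_N(x ↦ f(x+1)) + S_N(f)` converges to `(1+q) · f(0)`. -/
theorem stmt_8 (p : ℕ) [hp : Fact p.Prime] (hodd : p ≠ 2)
    (q : ℚ_[p]) (hq : ‖q - 1‖ < 1)
    (f : ℤ_[p] → ℚ_[p]) (hf : Continuous f) :
    Filter.Tendsto (fun N : ℕ =>
      q * (((1 + q) / (1 + q ^ (p ^ N))) *
        ∑ x ∈ Finset.range (p ^ N), f ((x : ℤ_[p]) + 1) * (-q) ^ x) +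
      ((1 + q) / (1 + q ^ (p ^ N))) *
        ∑ x ∈ Finset.range (p ^ N), f (x : ℤ_[p]) * (-q) ^ x)
      Filter.atTop (nhds ((1 + q) * f 0)) := by
  have hQ (N : ℕ) : ‖q ^ p ^ N - 1‖ < 1 := Padic.norm_pow_sub_one_lt_one hq _
  have hnorm (N : ℕ) : ‖1 + q ^ p ^ N‖ = 1 :=
    Padic.norm_one_add_of_norm_sub_one_lt_one hodd (hQ N)
  have hne (N : ℕ) : 1 + q ^ p ^ N ≠ 0 := fun h => by simpa [h] using hnorm N
  have hQ1 (N : ℕ) : ‖q ^ p ^ N‖ ≤ 1 := Padic.norm_le_one_of_norm_sub_one_lt_one (hQ N)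
  have hpow : Filter.Tendsto (fun N : ℕ => (p : ℤ_[p]) ^ N) Filter.atTop (nhds 0) :=
    tendsto_pow_atTop_nhds_zero_of_norm_lt_one <| by
      rw [PadicInt.norm_p]
      exact inv_lt_one_of_one_lt₀ (by exact_mod_cast hp.out.one_lt)
  have hlim : Filter.Tendsto (fun N : ℕ => ‖f ((p : ℤ_[p]) ^ N) - f 0‖) Filter.atTop (nhds 0) :=
    tendsto_iff_norm_sub_tendsto_zero.mp ((hf.tendsto 0).comp hpow)
  have hbound : Filter.Tendsto (fun N : ℕ => ‖1 + q‖ * ‖f ((p : ℤ_[p]) ^ N) - f 0‖)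
      Filter.atTop (nhds 0) := by
    simpa using hlim.const_mul ‖1 + q‖
  rw [tendsto_iff_norm_sub_tendsto_zero]
  refine squeeze_zero (fun _ => norm_nonneg _) (fun N => ?_) hbound
  have htel := mul_sum_range_shift_add_sum_range q (fun x : ℕ => f (x : ℤ_[p])) (p ^ N)
  have hoddpow : Odd (p ^ N) := (hp.out.odd_of_ne_two hodd).pow
  simp only [Nat.cast_add, Nat.cast_one, Nat.cast_zero, Nat.cast_pow, hoddpow.neg_pow] at htel
  have heq : q * (((1 + q) / (1 + q ^ (p ^ N))) *
        ∑ x ∈ Finset.range (p ^ N), f ((x : ℤ_[p]) + 1) * (-q) ^ x) +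
      ((1 + q) / (1 + q ^ (p ^ N))) *
        ∑ x ∈ Finset.range (p ^ N), f (x : ℤ_[p]) * (-q) ^ x - (1 + q) * f 0 =
      (1 + q) * (q ^ p ^ N * (f ((p : ℤ_[p]) ^ N) - f 0)) / (1 + q ^ p ^ N) := by
    have h := hne N
    field_simp
    linear_combination (1 + q) * htel
  rw [heq, norm_div, hnorm, div_one, norm_mul, norm_mul]
  exact mul_le_mul_of_nonneg_left (mul_le_of_le_one_left (norm_nonneg _) (hQ1 N)) (norm_nonneg _)
end

section
/- Let p be an odd prime, let q ∈ ℚ_p with ‖q - 1‖_p < 1, let n ≥ 1 be an integer, and let f : ℤ_p → ℚ_p be continuous. For N ≥ 1 set S_N(f) = ((1+q)/(1+q^{p^N})) · ∑_{x=0}^{p^N - 1} f(x) (-q)^x, where the natural number x is regarded as an element of ℤ_p. Then the sequence N ↦ q^n · S_N(x ↦ f(x+n)) - (-1)^n · S_N(f) converges, as N → ∞, to (1+q) · ∑_{l=0}^{n-1} (-1)^{n-1-l} q^l f(l). -/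
open Filter Topology in
theorem Padic.tendsto_pow_prime_pow_nhds_one {p : ℕ} [Fact p.Prime] {q : ℚ_[p]}
    (hq : ‖q - 1‖ < 1) : Tendsto (fun N : ℕ => q ^ (p ^ N)) atTop (𝓝 1) := by
  obtain ⟨r, hr⟩ : ∃ r : ℤ_[p], (r : ℚ_[p]) = q - 1 := ⟨⟨q - 1, hq.le⟩, rfl⟩
  have hdvd : (p : ℤ_[p]) ∣ (r + 1) - 1 := by
    rw [add_sub_cancel_right, ← PadicInt.norm_lt_one_iff_dvd, PadicInt.norm_def, hr]
    exact hq
  have hp0 : Tendsto (fun N : ℕ => ‖(p : ℤ_[p])‖ ^ (N + 1)) atTop (𝓝 0) :=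
    (tendsto_pow_atTop_nhds_zero_of_lt_one (norm_nonneg _) (PadicInt.norm_lt_one_iff_dvd _ |>.mpr dvd_rfl)).comp
      (tendsto_add_atTop_nat 1)
  rw [tendsto_iff_norm_sub_tendsto_zero]
  refine squeeze_zero (fun _ => norm_nonneg _) (fun N => ?_) hp0
  obtain ⟨c, hc⟩ := dvd_sub_pow_of_dvd_sub hdvd N
  have hc' := congrArg (fun z : ℤ_[p] => ‖z‖) hc
  simp only [one_pow, norm_mul, norm_pow] at hc'
  have hcoe : ‖q ^ p ^ N - 1‖ = ‖((r + 1) ^ p ^ N - 1)‖ := by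
    rw [PadicInt.norm_def]
    push_cast
    rw [hr, sub_add_cancel]
  rw [hcoe, hc']
  exact mul_le_of_le_one_right (by positivity) (PadicInt.norm_le_one c)

theorem Finset.sum_range_shift_sub_sum_range {M : Type*} [AddCommGroup M] (g : ℕ → M) (m n : ℕ) :
    ∑ x ∈ range m, g (x + n) - ∑ x ∈ range m, g x =
      ∑ l ∈ range n, (g (m + l) - g l) := by
  have h₁ := sum_range_add g m n
  have h₂ := sum_range_add g n m
  rw [add_comm n m, h₁] at h₂
  simp only [add_comm n] at h₂
  rw [sum_sub_distrib, sub_eq_sub_iff_add_eq_add, add_comm, ← h₂, add_comm]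

/-- Let `p` be an odd prime, `q ∈ ℚ_p` with `‖q-1‖_p < 1`, `n ≥ 1` an
integer, and `f : ℤ_p → ℚ_p` continuous. With
`S_N(f) = ((1+q)/(1+q^{p^N})) ∑_{x=0}^{p^N-1} f(x)(-q)^x`, the sequence
`N ↦ q^n · S_N(x ↦ f(x+n)) - (-1)^n · S_N(f)` converges to
`(1+q) · ∑_{l=0}^{n-1} (-1)^{n-1-l} q^l f(l)`. -/
theorem stmt_9 (p : ℕ) [hp : Fact p.Prime] (hodd : p ≠ 2)
    (q : ℚ_[p]) (hq : ‖q - 1‖ < 1) (n : ℕ) (hn : 1 ≤ n)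
    (f : ℤ_[p] → ℚ_[p]) (hf : Continuous f) :
    Filter.Tendsto (fun N : ℕ =>
      q ^ n * (((1 + q) / (1 + q ^ (p ^ N))) *
        ∑ x ∈ Finset.range (p ^ N), f ((x : ℤ_[p]) + (n : ℤ_[p])) * (-q) ^ x) -
      (-1) ^ n * (((1 + q) / (1 + q ^ (p ^ N))) *
        ∑ x ∈ Finset.range (p ^ N), f (x : ℤ_[p]) * (-q) ^ x))
      Filter.atTop
      (nhds ((1 + q) * ∑ l ∈ Finset.range n, (-1) ^ (n - 1 - l) * q ^ l * f (l : ℤ_[p]))) := by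
  have hpN : Filter.Tendsto (fun N : ℕ => (p : ℤ_[p]) ^ N) Filter.atTop (nhds 0) :=
    tendsto_pow_atTop_nhds_zero_of_norm_lt_one (PadicInt.norm_lt_one_iff_dvd _ |>.mpr dvd_rfl)
  have hqN := Padic.tendsto_pow_prime_pow_nhds_one hq
  have hlim : Filter.Tendsto (fun N : ℕ => ((1 + q) / (1 + q ^ (p ^ N))) *
      ((-1) ^ n * ∑ l ∈ Finset.range n,
        (f ((p : ℤ_[p]) ^ N + l) * (-q ^ (p ^ N)) - f l) * (-q) ^ l)) Filter.atTop
      (nhds (((1 + q) / (1 + 1)) * ((-1) ^ n * ∑ l ∈ Finset.range n,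
        (f (0 + l) * (-1) - f l) * (-q) ^ l))) := by
    refine (tendsto_const_nhds.div (hqN.const_add 1) (by norm_num)).mul
      (tendsto_const_nhds.mul (tendsto_finsetSum _ fun l _ => ?_))
    exact ((((hf.tendsto _).comp (hpN.add_const _)).mul hqN.neg).sub_const _).mul_const _
  convert hlim using 1
  · funext N
    have hodd' : Odd (p ^ N) := (hp.out.odd_of_ne_two hodd).pow
    have hshift := Finset.sum_range_shift_sub_sum_range
      (fun x : ℕ => f (x : ℤ_[p]) * (-q) ^ x) (p ^ N) n
    have hsum : ∑ l ∈ Finset.range n,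
        (f ((p : ℤ_[p]) ^ N + l) * (-q ^ (p ^ N)) - f l) * (-q) ^ l =
        ∑ l ∈ Finset.range n, (f ((p ^ N + l : ℕ) : ℤ_[p]) * (-q) ^ (p ^ N + l) -
          f (l : ℤ_[p]) * (-q) ^ l) := by
      refine Finset.sum_congr rfl fun l _ => ?_
      rw [pow_add, hodd'.neg_pow]
      push_cast
      ring
    have hmul : ∑ x ∈ Finset.range (p ^ N), f ((x + n : ℕ) : ℤ_[p]) * (-q) ^ (x + n) =
        (-q) ^ n * ∑ x ∈ Finset.range (p ^ N), f ((x : ℤ_[p]) + (n : ℤ_[p])) * (-q) ^ x := by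
      rw [Finset.mul_sum]
      refine Finset.sum_congr rfl fun x _ => ?_
      push_cast
      ring
    have hqn : q ^ n = (-1) ^ n * (-q) ^ n := by rw [← mul_pow]; simp
    rw [hsum, ← hshift, hmul, hqn]
    ring
  · congr 1
    rw [div_mul_eq_mul_div, mul_div_assoc]
    congr 1
    rw [Finset.mul_sum, Finset.sum_div]
    refine Finset.sum_congr rfl fun l hl => ?_
    obtain ⟨k, rfl⟩ := Nat.exists_eq_add_of_lt (Finset.mem_range.mp hl)
    have hk : l + k + 1 - 1 - l = k := by omega
    have hl2 : ((-1 : ℚ_[p]) ^ l) * (-1) ^ l = 1 := by rw [← mul_pow]; simp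
    rw [hk, zero_add, neg_pow q l, pow_succ, pow_add]
    linear_combination (-(-1 : ℚ_[p]) ^ k * q ^ l * f l) * hl2
end

section
/- Let p be an odd prime and let w ∈ ℤ_p with ‖w - 1‖_p < 1. Then there exists a sequence L : ℕ → ℚ_p such that: (i) for every n ≥ 0, the partial sums N ↦ ∑_{x=0}^{p^N - 1} (-1)^x w^x x^n converge in ℚ_p to L(n) as N → ∞; and (ii) for every n ≥ 0, w · ∑_{k=0}^n C(n,k) L(k) + L(n) = (2 if n = 0, else 0). (The numbers L(n) are the w-Euler numbers E_{n,w}, given by Witt's formula E_{n,w} = ∫_{ℤ_p} w^x x^n dμ_{-1}(x).) -/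
open Filter Topology

/-- The telescoping identity behind the recurrence for the `w`-Euler numbers. -/
theorem mul_sum_choose_mul_alternating_sum_add {R : Type*} [CommRing R] (a : R) (n M : ℕ) :
    a * ∑ k ∈ Finset.range (n + 1), (n.choose k : R) *
        ∑ x ∈ Finset.range M, (-1 : R) ^ x * a ^ x * (x : R) ^ k +
      ∑ x ∈ Finset.range M, (-1 : R) ^ x * a ^ x * (x : R) ^ n =
    0 ^ n - (-1) ^ M * a ^ M * (M : R) ^ n := by
  induction M with
  | zero => simp
  | succ M ih =>
    have binom : ((M : R) + 1) ^ n =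
        ∑ k ∈ Finset.range (n + 1), (n.choose k : R) * (M : R) ^ k := by
      simp [add_pow, mul_comm]
    have split : ∑ k ∈ Finset.range (n + 1),
        (n.choose k : R) * ((-1 : R) ^ M * a ^ M * (M : R) ^ k) =
        (-1 : R) ^ M * a ^ M * ((M : R) + 1) ^ n := by
      rw [binom, Finset.mul_sum]
      exact Finset.sum_congr rfl fun k _ => by ring
    simp only [Finset.sum_range_succ _ M, mul_add, Finset.sum_add_distrib, split]
    push_cast
    linear_combination ih

theorem PadicInt.tendsto_pow_prime_pow_of_norm_sub_one_lt_one {p : ℕ} [Fact p.Prime]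
    {w : ℤ_[p]} (hw : ‖w - 1‖ < 1) :
    Tendsto (fun N : ℕ => (w : ℚ_[p]) ^ p ^ N) atTop (𝓝 1) := by
  have hdvd : (p : ℤ_[p]) ∣ w - 1 := PadicInt.norm_lt_one_iff_dvd _ |>.mp hw
  have key (N : ℕ) : ‖(w : ℚ_[p]) ^ p ^ N - 1‖ ≤ ‖(p : ℚ_[p])‖ ^ N := by
    obtain ⟨c, hc⟩ := dvd_sub_pow_of_dvd_sub hdvd N
    have hc' : (w : ℚ_[p]) ^ p ^ N - 1 = (p : ℚ_[p]) ^ N * ((p * c : ℤ_[p]) : ℚ_[p]) := by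
      have := congrArg (fun z : ℤ_[p] => (z : ℚ_[p])) hc
      push_cast at this ⊢
      rw [one_pow] at this
      rw [this]
      ring
    rw [hc', norm_mul, norm_pow]
    exact mul_le_of_le_one_right (by positivity) (PadicInt.norm_le_one _)
  rw [tendsto_iff_norm_sub_tendsto_zero]
  exact squeeze_zero (fun _ => norm_nonneg _) key
    (tendsto_pow_atTop_nhds_zero_of_lt_one (norm_nonneg _) Padic.norm_p_lt_one)

theorem PadicInt.add_one_ne_zero_of_norm_sub_one_lt_one {p : ℕ} [Fact p.Prime] (hodd : p ≠ 2)
    {w : ℤ_[p]} (hw : ‖w - 1‖ < 1) : w + 1 ≠ 0 := by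
  intro h
  have h2 : ‖((2 : ℕ) : ℤ_[p])‖ < 1 := by
    have : w - 1 = -((2 : ℕ) : ℤ_[p]) := by push_cast; linear_combination h
    rwa [this, norm_neg] at hw
  rw [← Int.cast_natCast, PadicInt.norm_int_lt_one_iff_dvd, Int.natCast_dvd_natCast] at h2
  exact hodd ((Nat.prime_dvd_prime_iff_eq Fact.out Nat.prime_two).mp h2)


/-- Let `p` be an odd prime and `w ∈ ℤ_p` with `‖w-1‖_p < 1`. There is a
sequence `L : ℕ → ℚ_p` (the `w`-Euler numbers `E_{n,w}`) such that (i) for every `n`,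
`∑_{x=0}^{p^N-1} (-1)^x w^x x^n → L n` as `N → ∞`, and (ii) for every `n`,
`w · ∑_{k=0}^n C(n,k) L k + L n = 2·δ_{n,0}`. -/
theorem stmt_10 (p : ℕ) [hp : Fact p.Prime] (hodd : p ≠ 2)
    (w : ℤ_[p]) (hw : ‖w - 1‖ < 1) :
    ∃ L : ℕ → ℚ_[p],
      (∀ n : ℕ, Filter.Tendsto (fun N : ℕ =>
        ∑ x ∈ Finset.range (p ^ N), (-1 : ℚ_[p]) ^ x * (w : ℚ_[p]) ^ x * (x : ℚ_[p]) ^ n)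
        Filter.atTop (nhds (L n))) ∧
      (∀ n : ℕ, (w : ℚ_[p]) * ∑ k ∈ Finset.range (n + 1), (n.choose k : ℚ_[p]) * L k + L n =
        if n = 0 then 2 else 0) := by
  have hodd' : Odd p := hp.out.odd_of_ne_two hodd
  have hw1 : (w : ℚ_[p]) + 1 ≠ 0 := fun h =>
    PadicInt.add_one_ne_zero_of_norm_sub_one_lt_one hodd hw (Subtype.ext (by push_cast; exact h))
  set S : ℕ → ℕ → ℚ_[p] := fun n N =>
    ∑ x ∈ Finset.range (p ^ N), (-1 : ℚ_[p]) ^ x * (w : ℚ_[p]) ^ x * (x : ℚ_[p]) ^ n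
  have rec_tendsto (n : ℕ) : Tendsto (fun N => (w : ℚ_[p]) *
      ∑ k ∈ Finset.range (n + 1), (n.choose k : ℚ_[p]) * S k N + S n N)
      atTop (𝓝 (if n = 0 then 2 else 0)) := by
    have hp0 : Tendsto (fun N : ℕ => ((p : ℚ_[p]) ^ N) ^ n) atTop (𝓝 (0 ^ n)) :=
      (tendsto_pow_atTop_nhds_zero_of_norm_lt_one Padic.norm_p_lt_one).pow n
    have hlim := ((PadicInt.tendsto_pow_prime_pow_of_norm_sub_one_lt_one hw).mul hp0).const_add
      ((0 : ℚ_[p]) ^ n)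
    convert hlim using 2 with N
    · simp only [S]
      rw [mul_sum_choose_mul_alternating_sum_add, hodd'.pow.neg_one_pow]
      push_cast
      ring
    · rcases eq_or_ne n 0 with rfl | hn
      · norm_num
      · simp [hn]
  have conv (n : ℕ) : ∃ l, Tendsto (S n) atTop (𝓝 l) := by
    induction n using Nat.strong_induction_on with
    | _ n ih =>
      choose! L hL using ih
      have hsum : Tendsto (fun N => ∑ k ∈ Finset.range n, (n.choose k : ℚ_[p]) * S k N) atTop
          (𝓝 (∑ k ∈ Finset.range n, (n.choose k : ℚ_[p]) * L k)) :=
        tendsto_finsetSum _ fun k hk => (hL k (Finset.mem_range.mp hk)).const_mul _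
      refine ⟨_, (((rec_tendsto n).sub (hsum.const_mul (w : ℚ_[p]))).div_const
        ((w : ℚ_[p]) + 1)).congr fun N => ?_⟩
      rw [Finset.sum_range_succ, Nat.choose_self, div_eq_iff hw1]
      push_cast
      ring
  choose L hL using conv
  refine ⟨L, hL, fun n => tendsto_nhds_unique ?_ (rec_tendsto n)⟩
  exact ((tendsto_finsetSum _ fun k _ => (hL k).const_mul _).const_mul _).add (hL n)
end

section
/- Let p be an odd prime, let r ≥ 1 and n ≥ 0 be integers, and let w ∈ ℤ_p with ‖w - 1‖_p < 1. Suppose L : ℕ → ℚ_p is a sequence such that for every k ≥ 0 the partial sums N ↦ ∑_{x=0}^{p^N - 1} (-1)^x w^x x^k converge to L(k). Then the r-fold sums N ↦ ∑_{x_1=0}^{p^N-1} ⋯ ∑_{x_r=0}^{p^N-1} (-1)^{x_1+⋯+x_r} w^{x_1+⋯+x_r} (x_1+⋯+x_r)^n converge, as N → ∞, to ∑ over all (k_1,…,k_r) ∈ ℕ^r with k_1+⋯+k_r = n of the multinomial coefficient n!/(k_1!⋯k_r!) times L(k_1)⋯L(k_r). (This is Witt's formula E_{n,w}^{(r)} =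 ∫_{ℤ_p}⋯∫_{ℤ_p} w^{x_1+⋯+x_r}(x_1+⋯+x_r)^n dμ_{-1}(x_1)⋯dμ_{-1}(x_r) for the w-Euler numbers of order r.) -/
/-- The multinomial theorem for tuples, factored through a product of geometric weights and summed
over a box. -/
theorem sum_piFinset_pow_mul_sum_pow {R : Type*} [CommSemiring R] (r n : ℕ) (s : Finset ℕ)
    (a b : R) :
    ∑ x ∈ Fintype.piFinset (fun _ : Fin r => s),
        a ^ (∑ i, x i) * b ^ (∑ i, x i) * ((∑ i, x i : ℕ) : R) ^ n =
      ∑ k ∈ Finset.Nat.antidiagonalTuple r n, (Nat.multinomial Finset.univ k : R) *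
        ∏ i, ∑ x ∈ s, a ^ x * b ^ x * (x : R) ^ k i := by
  have h : Finset.Nat.antidiagonalTuple r n = Finset.piAntidiag Finset.univ n := by
    ext k
    simp [Finset.Nat.mem_antidiagonalTuple]
  simp_rw [h, Finset.prod_univ_sum, Finset.mul_sum]
  rw [Finset.sum_comm]
  refine Finset.sum_congr rfl fun x _ => ?_
  rw [Nat.cast_sum, Finset.sum_pow_eq_sum_piAntidiag, Finset.mul_sum]
  refine Finset.sum_congr rfl fun k _ => ?_
  simp only [Finset.prod_mul_distrib, Finset.prod_pow_eq_pow_sum]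
  ring

/-- Let `p` be an odd prime, `r ≥ 1`, `n ≥ 0` integers, and `w ∈ ℤ_p` with
`‖w-1‖_p < 1`. If `L : ℕ → ℚ_p` satisfies
`∑_{x=0}^{p^N-1} (-1)^x w^x x^k → L k` for every `k`, then the `r`-fold sums
`∑_{x_1,…,x_r=0}^{p^N-1} (-1)^{x_1+⋯+x_r} w^{x_1+⋯+x_r} (x_1+⋯+x_r)^n` converge to
`∑_{k_1+⋯+k_r=n} (n!/(k_1!⋯k_r!)) L(k_1)⋯L(k_r)`. -/
theorem stmt_11 (p : ℕ) [hp : Fact p.Prime] (hodd : p ≠ 2)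
    (r : ℕ) (hr : 1 ≤ r) (n : ℕ) (w : ℤ_[p]) (hw : ‖w - 1‖ < 1)
    (L : ℕ → ℚ_[p])
    (hL : ∀ k : ℕ, Filter.Tendsto (fun N : ℕ =>
      ∑ x ∈ Finset.range (p ^ N), (-1 : ℚ_[p]) ^ x * (w : ℚ_[p]) ^ x * (x : ℚ_[p]) ^ k)
      Filter.atTop (nhds (L k))) :
    Filter.Tendsto (fun N : ℕ =>
      ∑ x ∈ Fintype.piFinset (fun _ : Fin r => Finset.range (p ^ N)),
        (-1 : ℚ_[p]) ^ (∑ i, x i) * (w : ℚ_[p]) ^ (∑ i, x i) * ((∑ i, x i : ℕ) : ℚ_[p]) ^ n)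
      Filter.atTop
      (nhds (∑ k ∈ Finset.Nat.antidiagonalTuple r n,
        (Nat.multinomial Finset.univ k : ℚ_[p]) * ∏ i, L (k i))) := by
  simp_rw [sum_piFinset_pow_mul_sum_pow]
  exact tendsto_finsetSum _ fun k _ =>
    (tendsto_finsetProd _ fun i _ => hL (k i)).const_mul _
end

section
/- Let p be an odd prime, let r ≥ 1 and n ≥ 0 be integers, and let q, w ∈ ℚ_p with ‖q - 1‖_p < 1, q ≠ 1, and ‖w - 1‖_p < 1. Then the r-fold sums N ↦ ((1+q)/(1+q^{p^N}))^r · ∑_{x_1=0}^{p^N-1} ⋯ ∑_{x_r=0}^{p^N-1} (-1)^{x_1+⋯+x_r} w^{x_1+⋯+x_r} [x_1+⋯+x_r]_q^n converge in ℚ_p, as N → ∞, to (1/(1-q)^n) · ∑_{l=0}^n C(n,l)(-1)^l ((1+q)/(1+w q^l))^r. (This is Witt's formula E_{n,w,q}^{(r)} = ∫_{ℤ_p}⋯∫_{ℤ_p} w^{x_1+⋯+x_r} q^{-(x_1+⋯+x_r)} [x_1+⋯+x_r]_q^n dμ_{-q}(x_1)⋯dμ_{-q}(x_r) for the w-q-Euler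 numbers of order r.) -/
section PrincipalUnits

variable {p : ℕ} [hp : Fact p.Prime] {a b : ℚ_[p]}

theorem Padic.norm_eq_one_of_norm_sub_one_lt_one (ha : ‖a - 1‖ < 1) : ‖a‖ = 1 := by
  have h := Padic.add_eq_max_of_ne (q := a - 1) (r := 1) (by simpa using ha.ne)
  rwa [sub_add_cancel, norm_one, max_eq_right ha.le] at h

theorem Padic.norm_mul_sub_one_lt_one (ha : ‖a - 1‖ < 1) (hb : ‖b - 1‖ < 1) :
    ‖a * b - 1‖ < 1 := by
  have h : a * b - 1 = a * (b - 1) + (a - 1) := by ring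
  rw [h]
  refine (Padic.nonarchimedean _ _).trans_lt (max_lt ?_ ha)
  rwa [norm_mul, Padic.norm_eq_one_of_norm_sub_one_lt_one ha, one_mul]

theorem Padic.norm_pow_sub_one_lt_one_s13 (ha : ‖a - 1‖ < 1) (n : ℕ) : ‖a ^ n - 1‖ < 1 := by
  induction n with
  | zero => simp
  | succ n ih => rw [pow_succ]; exact Padic.norm_mul_sub_one_lt_one ih ha

theorem Padic.one_add_ne_zero_of_norm_sub_one_lt_one (hodd : p ≠ 2) (ha : ‖a - 1‖ < 1) :
    1 + a ≠ 0 := by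
  intro h
  have h2 : a - 1 = -((2 : ℕ) : ℚ_[p]) := by push_cast; linear_combination h
  rw [h2, norm_neg, Padic.norm_natCast_lt_one_iff] at ha
  exact hodd ((Nat.prime_dvd_prime_iff_eq hp.out Nat.prime_two).mp ha)

theorem Padic.tendsto_pow_prime_pow_of_norm_sub_one_lt_one (ha : ‖a - 1‖ < 1) :
    Filter.Tendsto (fun N : ℕ => a ^ p ^ N) Filter.atTop (nhds 1) := by
  obtain ⟨a, rfl⟩ : ∃ b : ℤ_[p], (b : ℚ_[p]) = a :=
    ⟨⟨a, (Padic.norm_eq_one_of_norm_sub_one_lt_one ha).le⟩, rfl⟩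
  have hdvd : (p : ℤ_[p]) ∣ a - 1 := (PadicInt.norm_lt_one_iff_dvd _).mp (by exact_mod_cast ha)
  rw [tendsto_iff_norm_sub_tendsto_zero]
  have hlim : Filter.Tendsto (fun N : ℕ => ‖(p : ℚ_[p])‖ ^ (N + 1)) Filter.atTop (nhds 0) :=
    (tendsto_pow_atTop_nhds_zero_of_lt_one (norm_nonneg _) Padic.norm_p_lt_one).comp
      (Filter.tendsto_add_atTop_nat 1)
  refine squeeze_zero (fun _ => norm_nonneg _) (fun N => ?_) hlim
  obtain ⟨c, hc⟩ := dvd_sub_pow_of_dvd_sub hdvd N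
  have hc' : (a : ℚ_[p]) ^ p ^ N - 1 = (p : ℚ_[p]) ^ (N + 1) * c := by
    rw [one_pow] at hc
    exact_mod_cast congrArg ((↑) : ℤ_[p] → ℚ_[p]) hc
  rw [hc', norm_mul, norm_pow]
  exact mul_le_of_le_one_right (by positivity) c.norm_le_one

end PrincipalUnits

theorem sum_piFinset_pow_sum {R : Type*} [CommSemiring R] (r : ℕ) (s : Finset ℕ) (b : R) :
    ∑ x ∈ Fintype.piFinset (fun _ : Fin r => s), b ^ (∑ i, x i) = (∑ k ∈ s, b ^ k) ^ r := by
  simp_rw [Finset.sum_pow', ← Finset.prod_pow_eq_pow_sum]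

theorem one_sub_div_pow_eq_sum {K : Type*} [Field K] (y c : K) (n : ℕ) :
    ((1 - y) / c) ^ n =
      1 / c ^ n * ∑ l ∈ Finset.range (n + 1), (n.choose l : K) * (-1) ^ l * y ^ l := by
  rw [div_pow, sub_eq_neg_add, add_pow, div_eq_mul_one_div, mul_comm]
  congr 1
  refine Finset.sum_congr rfl fun l _ => ?_
  rw [neg_pow y, one_pow]
  ring

theorem sum_piFinset_neg_one_pow_mul {K : Type*} [Field K] (r n M : ℕ) (w q c : K) :
    ∑ x ∈ Fintype.piFinset (fun _ : Fin r => Finset.range M),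
        (-1 : K) ^ (∑ i, x i) * w ^ (∑ i, x i) * ((1 - q ^ (∑ i, x i)) / c) ^ n =
      1 / c ^ n * ∑ l ∈ Finset.range (n + 1), (n.choose l : K) * (-1) ^ l *
        (∑ k ∈ Finset.range M, (-(w * q ^ l)) ^ k) ^ r := by
  simp_rw [one_sub_div_pow_eq_sum, ← sum_piFinset_pow_sum, Finset.mul_sum]
  rw [Finset.sum_comm]
  refine Finset.sum_congr rfl fun l _ => Finset.sum_congr rfl fun x _ => ?_
  rw [neg_pow (w * q ^ l), mul_pow, ← pow_mul, ← pow_mul, mul_comm l]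
  ring

theorem Padic.tendsto_div_mul_sum_neg_pow {p : ℕ} [hp : Fact p.Prime] (hodd : p ≠ 2)
    {q a : ℚ_[p]} (hq : ‖q - 1‖ < 1) (ha : ‖a - 1‖ < 1) :
    Filter.Tendsto (fun N : ℕ =>
      (1 + q) / (1 + q ^ p ^ N) * ∑ k ∈ Finset.range (p ^ N), (-a) ^ k)
      Filter.atTop (nhds ((1 + q) / (1 + a))) := by
  have hne := Padic.one_add_ne_zero_of_norm_sub_one_lt_one hodd ha
  have hgeom (N : ℕ) : ∑ k ∈ Finset.range (p ^ N), (-a) ^ k = (1 + a ^ p ^ N) / (1 + a) := by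
    have h := mul_neg_geom_sum (-a) (p ^ N)
    rw [((hp.out.odd_of_ne_two hodd).pow).neg_pow, sub_neg_eq_add, sub_neg_eq_add] at h
    rw [eq_div_iff hne, mul_comm, h]
  simp_rw [hgeom]
  have h2 : (1 : ℚ_[p]) + 1 ≠ 0 := by norm_num
  have hqlim := (Padic.tendsto_pow_prime_pow_of_norm_sub_one_lt_one hq).const_add 1
  have halim := (Padic.tendsto_pow_prime_pow_of_norm_sub_one_lt_one ha).const_add 1
  convert! ((tendsto_const_nhds (x := 1 + q)).div hqlim h2).mul (halim.div_const (1 + a)) using 2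
  field_simp


/-- Let `p` be an odd prime, `r ≥ 1`, `n ≥ 0` integers, and `q, w ∈ ℚ_p`
with `‖q-1‖_p < 1`, `q ≠ 1`, `‖w-1‖_p < 1`. Then the `r`-fold sums
`((1+q)/(1+q^{p^N}))^r ∑_{x_1,…,x_r=0}^{p^N-1} (-1)^{x_1+⋯+x_r} w^{x_1+⋯+x_r} [x_1+⋯+x_r]_q^n`
converge, as `N → ∞`, to `(1/(1-q)^n) ∑_{l=0}^n C(n,l)(-1)^l ((1+q)/(1+w q^l))^r`,
where `[x]_q = (1-q^x)/(1-q)`. -/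
theorem stmt_13 (p : ℕ) [hp : Fact p.Prime] (hodd : p ≠ 2)
    (r : ℕ) (hr : 1 ≤ r) (n : ℕ)
    (q w : ℚ_[p]) (hq : ‖q - 1‖ < 1) (hq1 : q ≠ 1) (hw : ‖w - 1‖ < 1) :
    Filter.Tendsto (fun N : ℕ =>
      ((1 + q) / (1 + q ^ (p ^ N))) ^ r *
        ∑ x ∈ Fintype.piFinset (fun _ : Fin r => Finset.range (p ^ N)),
          (-1 : ℚ_[p]) ^ (∑ i, x i) * w ^ (∑ i, x i) *
            ((1 - q ^ (∑ i, x i)) / (1 - q)) ^ n)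
      Filter.atTop
      (nhds ((1 / (1 - q) ^ n) * ∑ l ∈ Finset.range (n + 1),
        (n.choose l : ℚ_[p]) * (-1) ^ l * ((1 + q) / (1 + w * q ^ l)) ^ r)) := by
  simp_rw [sum_piFinset_neg_one_pow_mul, mul_left_comm _ (1 / (1 - q) ^ n),
    Finset.mul_sum _ _ (_ ^ r), mul_left_comm (_ ^ r), ← mul_pow]
  exact (tendsto_finsetSum _ fun l _ => ((Padic.tendsto_div_mul_sum_neg_pow hodd hq
    (Padic.norm_mul_sub_one_lt_one hw (Padic.norm_pow_sub_one_lt_one_s13 hq l))).pow r).const_mul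
      _).const_mul _
end

section
/- Let r ≥ 1 be an integer, let q ∈ ℝ with 0 < q < 1, let w ∈ ℂ with |w| < 1, and let x ∈ ℝ with x ≥ 0. Then for every t ∈ ℂ the series F_x(t) := (1+q)^r ∑_{m=0}^∞ C(m+r-1,m)(-1)^m w^m exp([m+x]_q · t) converges absolutely, and F_x(t) = ∑_{n=0}^∞ E_n(x) t^n / n!, where E_n(x) = (1+q)^r ∑_{m=0}^∞ C(m+r-1,m)(-1)^m w^m [m+x]_q^n, the latter series in t also converging for every t ∈ ℂ. -/
/-- If `a` is absolutely summable and `y` is bounded by `B`, then `∑ a m * exp (y m * t)` is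
absolutely summable. -/
theorem summable_norm_mul_exp_of_norm_le {a y : ℕ → ℂ} {B : ℝ} (ha : Summable fun m => ‖a m‖)
    (hy : ∀ m, ‖y m‖ ≤ B) (t : ℂ) : Summable fun m => ‖a m * Complex.exp (y m * t)‖ := by
  refine Summable.of_nonneg_of_le (fun _ => norm_nonneg _) (fun m => ?_)
    (ha.mul_right (Real.exp (B * ‖t‖)))
  rw [norm_mul]
  gcongr
  refine (Complex.norm_exp_le_exp_norm _).trans (Real.exp_le_exp.mpr ?_)
  rw [norm_mul]
  gcongr
  exact hy m

/-- If `a` is absolutely summable and `y` is bounded by `B`, then `∑ a m * exp (y m * t)` may be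
expanded as a power series in `t` by interchanging the two summations. -/
theorem hasSum_tsum_mul_pow_mul_pow_div_factorial {a y : ℕ → ℂ} {B : ℝ}
    (ha : Summable fun m => ‖a m‖) (hy : ∀ m, ‖y m‖ ≤ B) (t : ℂ) :
    HasSum (fun n : ℕ => (∑' m, a m * y m ^ n) * t ^ n / (n.factorial : ℂ))
      (∑' m, a m * Complex.exp (y m * t)) := by
  have hf : Summable fun p : ℕ × ℕ => a p.1 * ((y p.1 * t) ^ p.2 / (p.2.factorial : ℂ)) := by
    have hB : 0 ≤ B := (norm_nonneg _).trans (hy 0)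
    refine Summable.of_norm_bounded (ha.mul_of_nonneg
      (Real.summable_pow_div_factorial (B * ‖t‖)) (fun _ => norm_nonneg _)
      (fun _ => by positivity)) (fun p => ?_)
    rw [norm_mul, norm_div, norm_pow, norm_mul, Complex.norm_natCast]
    gcongr
    exact hy p.1
  have hrow (m : ℕ) : HasSum (fun n : ℕ => a m * ((y m * t) ^ n / (n.factorial : ℂ)))
      (a m * Complex.exp (y m * t)) := by
    rw [Complex.exp_eq_exp_ℂ]
    exact (NormedSpace.expSeries_div_hasSum_exp (y m * t)).mul_left (a m)
  rw [(hf.hasSum.prod_fiberwise hrow).tsum_eq]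
  have hswap := (Equiv.prodComm ℕ ℕ).hasSum_iff.mpr hf.hasSum
  have hcol := hswap.prod_fiberwise fun n => (hswap.summable.prod_factor n).hasSum
  convert! hcol using 2 with n
  rw [mul_div_assoc, ← tsum_mul_right]
  refine tsum_congr fun m => ?_
  simp only [Function.comp_apply, Equiv.prodComm_apply, Prod.swap_prod_mk]
  ring

/-- The `q`-number `[s]_q` lies in `[0, (1 - q)⁻¹]` for `s ≥ 0`. -/
theorem norm_one_sub_rpow_div_one_sub_le {q s : ℝ} (hq0 : 0 < q) (hq1 : q < 1) (hs : 0 ≤ s) :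
    ‖(((1 - q ^ s) / (1 - q) : ℝ) : ℂ)‖ ≤ 1 / (1 - q) := by
  have h1 : 0 < 1 - q := sub_pos.mpr hq1
  have h2 : 0 < q ^ s := Real.rpow_pos_of_pos hq0 s
  have h3 : q ^ s ≤ 1 := Real.rpow_le_one hq0.le hq1.le hs
  rw [Complex.norm_real, Real.norm_of_nonneg (div_nonneg (by linarith) h1.le)]
  gcongr
  linarith

/-- For an integer `r ≥ 1`, real `0 < q < 1`, complex `|w| < 1` and real
`x ≥ 0`, for every `t ∈ ℂ` the series
`F_x(t) = (1+q)^r ∑_{m=0}^∞ C(m+r-1,m)(-1)^m w^m exp([m+x]_q t)` converges absolutely and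
`F_x(t) = ∑_{n=0}^∞ E n x · t^n/n!`, where
`E n x = (1+q)^r ∑_{m=0}^∞ C(m+r-1,m)(-1)^m w^m [m+x]_q^n`, the latter series in `t`
converging for every `t ∈ ℂ`. Here `[y]_q = (1-q^y)/(1-q)` with `q^y` the real power. -/
theorem stmt_14 (r : ℕ) (hr : 1 ≤ r) (q : ℝ) (hq0 : 0 < q) (hq1 : q < 1)
    (w : ℂ) (hw : ‖w‖ < 1) (x : ℝ) (hx : 0 ≤ x)
    (E : ℕ → ℂ)
    (hE : ∀ n : ℕ, E n = ((1 : ℂ) + (q : ℂ)) ^ r * ∑' m : ℕ,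
      ((m + r - 1).choose m : ℂ) * (-1) ^ m * w ^ m *
        ((((1 - q ^ ((m : ℝ) + x)) / (1 - q) : ℝ) : ℂ)) ^ n) :
    ∀ t : ℂ,
      Summable (fun m : ℕ =>
        ‖((1 : ℂ) + (q : ℂ)) ^ r * ((m + r - 1).choose m : ℂ) * (-1) ^ m * w ^ m *
          Complex.exp ((((1 - q ^ ((m : ℝ) + x)) / (1 - q) : ℝ) : ℂ) * t)‖) ∧
      HasSum (fun n : ℕ => E n * t ^ n / (n.factorial : ℂ))
        (((1 : ℂ) + (q : ℂ)) ^ r * ∑' m : ℕ,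
          ((m + r - 1).choose m : ℂ) * (-1) ^ m * w ^ m *
            Complex.exp ((((1 - q ^ ((m : ℝ) + x)) / (1 - q) : ℝ) : ℂ) * t)) := by
  intro t
  have ha := summable_norm_choose_mul_neg_one_pow_mul_pow hr hw
  have hy (m : ℕ) := norm_one_sub_rpow_div_one_sub_le hq0 hq1 (add_nonneg m.cast_nonneg hx)
  constructor
  · refine ((summable_norm_mul_exp_of_norm_le ha hy t).mul_left
      ‖((1 : ℂ) + (q : ℂ)) ^ r‖).congr fun m => ?_
    rw [← norm_mul]
    simp only [mul_assoc]
  · convert! (hasSum_tsum_mul_pow_mul_pow_div_factorial ha hy t).mul_left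
      (((1 : ℂ) + (q : ℂ)) ^ r) using 2 with n
    rw [hE n]
    ring
end
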